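/- arXiv:2408.03671 — 5 statements merged into one kernel-verified Lean document; each statement's English description precedes it below -/
import Mathlib

section
/- Let X be an ordered Banach space whose positive cone X₊ is norm closed and generating (X = X₊ − X₊), let Y be a normed space, and let 𝒯 be a set of linear operators from X to Y such that 𝒯[0,b] = {T x : T ∈ 𝒯, 0 ≤ x ≤ b} is norm bounded for every b ∈ X₊. Then 𝒯 is bounded in the operator norm: there exists M ≥ 0 such that ‖T x‖ ≤ M‖x‖ for all T ∈ 𝒯 and all x ∈ X. -/
/-- Uniform boundedness on order intervals implies uniform boundedness on the positive part of
the unit ball. -/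
theorem exists_norm_le_on_nonneg_unitBall
    {X Y : Type*} [NormedAddCommGroup X] [NormedSpace ℝ X] [CompleteSpace X]
    [PartialOrder X] [IsOrderedAddMonoid X] [OrderClosedTopology X] [PosSMulMono ℝ X]
    [NormedAddCommGroup Y] [NormedSpace ℝ Y] (𝒯 : Set (X →ₗ[ℝ] Y))
    (h : ∀ b : X, 0 ≤ b → ∃ C : ℝ, ∀ T ∈ 𝒯, ∀ x : X, 0 ≤ x → x ≤ b → ‖T x‖ ≤ C) :
    ∃ C : ℝ, ∀ T ∈ 𝒯, ∀ x : X, 0 ≤ x → ‖x‖ ≤ 1 → ‖T x‖ ≤ C := by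
  by_contra! hC
  choose T hT x hx0 hx1 hTx using fun n : ℕ => hC (4 ^ n)
  have hnonneg (n : ℕ) : 0 ≤ ((1 / 2 : ℝ) ^ n) • x n := smul_nonneg (by positivity) (hx0 n)
  have hsum : Summable fun n : ℕ => ((1 / 2 : ℝ) ^ n) • x n := by
    refine Summable.of_norm_bounded summable_geometric_two fun n => ?_
    rw [norm_smul, Real.norm_of_nonneg (by positivity)]
    exact mul_le_of_le_one_right (by positivity) (hx1 n)
  obtain ⟨C, hb⟩ := h (∑' n : ℕ, ((1 / 2 : ℝ) ^ n) • x n) (tsum_nonneg hnonneg)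
  obtain ⟨n, hn⟩ := pow_unbounded_of_one_lt C (one_lt_two (α := ℝ))
  have hle := hb (T n) (hT n) _ (hnonneg n) (hsum.le_tsum n fun j _ => hnonneg j)
  rw [map_smul, norm_smul, Real.norm_of_nonneg (by positivity)] at hle
  have hlt : (2 : ℝ) ^ n < (1 / 2 : ℝ) ^ n * ‖T n (x n)‖ := by
    calc (2 : ℝ) ^ n = (1 / 2 : ℝ) ^ n * 4 ^ n := by rw [← mul_pow]; norm_num
      _ < _ := mul_lt_mul_of_pos_left (hTx n) (by positivity)
  linarith

/-- An absolutely summable scalar family multiplied by a bounded family is summable. -/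
theorem summable_smul_of_norm_le_one {ι X : Type*} [NormedAddCommGroup X] [NormedSpace ℝ X]
    [CompleteSpace X] {c : ι → ℝ} (hc : Summable fun i => ‖c i‖) {u : ι → X}
    (hu : ∀ i, ‖u i‖ ≤ 1) : Summable fun i => c i • u i :=
  Summable.of_norm_bounded hc fun i => by
    rw [norm_smul]; exact mul_le_of_le_one_right (norm_nonneg _) (hu i)

theorem norm_tsum_smul_le_of_norm_le_one {ι X : Type*} [NormedAddCommGroup X] [NormedSpace ℝ X]
    {c : ι → ℝ} (hc : Summable fun i => ‖c i‖) {u : ι → X}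
    (hu : ∀ i, ‖u i‖ ≤ 1) : ‖∑' i, c i • u i‖ ≤ ∑' i, ‖c i‖ :=
  tsum_of_norm_bounded hc.hasSum fun i => by
    rw [norm_smul]; exact mul_le_of_le_one_right (norm_nonneg _) (hu i)

theorem lp_one_summable_norm {ι : Type*} (f : lp (fun _ : ι => ℝ) 1) :
    Summable fun i => ‖f i‖ := by
  simpa using (lp.memℓp f).summable (by simp)

theorem lp_one_norm_eq_tsum {ι : Type*} (f : lp (fun _ : ι => ℝ) 1) :
    ‖f‖ = ∑' i, ‖f i‖ := by
  simpa using lp.norm_eq_tsum_rpow (p := 1) (by simp) f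

/-- The operator from `ℓ¹` sending the unit vectors to a given family in the unit ball. -/
noncomputable def lpOneLift {ι X : Type*} [NormedAddCommGroup X] [NormedSpace ℝ X]
    [CompleteSpace X] (u : ι → X) (hu : ∀ i, ‖u i‖ ≤ 1) : lp (fun _ : ι => ℝ) 1 →L[ℝ] X :=
  LinearMap.mkContinuous
    { toFun := fun f => ∑' i, f i • u i
      map_add' := fun f g => by
        rw [← (summable_smul_of_norm_le_one (lp_one_summable_norm f) hu).tsum_add
          (summable_smul_of_norm_le_one (lp_one_summable_norm g) hu)]
        simp [add_smul]
      map_smul' := fun r f => by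
        rw [RingHom.id_apply,
          ← (summable_smul_of_norm_le_one (lp_one_summable_norm f) hu).tsum_const_smul]
        simp [mul_smul] }
    1 fun f => by
      rw [one_mul, lp_one_norm_eq_tsum]
      exact norm_tsum_smul_le_of_norm_le_one (lp_one_summable_norm f) hu

theorem lpOneLift_apply {ι X : Type*} [NormedAddCommGroup X] [NormedSpace ℝ X]
    [CompleteSpace X] (u : ι → X) (hu : ∀ i, ‖u i‖ ≤ 1) (f : lp (fun _ : ι => ℝ) 1) :
    lpOneLift u hu f = ∑' i, f i • u i := rfl

theorem lpOneLift_single {ι X : Type*} [DecidableEq ι] [NormedAddCommGroup X] [NormedSpace ℝ X]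
    [CompleteSpace X] (u : ι → X) (hu : ∀ i, ‖u i‖ ≤ 1) (i : ι) (c : ℝ) :
    lpOneLift u hu (lp.single 1 i c) = c • u i := by
  rw [lpOneLift_apply, tsum_eq_single i]
  · simp
  · intro j hj
    simp [lp.single_apply, hj]

/-- The Krein–Shmulyan theorem: a closed generating cone in a Banach space gives decompositions
with norm control. -/
theorem exists_nonneg_sub_nonneg_norm_le
    {X : Type*} [NormedAddCommGroup X] [NormedSpace ℝ X] [CompleteSpace X]
    [PartialOrder X] [IsOrderedAddMonoid X] [OrderClosedTopology X] [PosSMulMono ℝ X]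
    (hgen : ∀ x : X, ∃ y z : X, 0 ≤ y ∧ 0 ≤ z ∧ x = y - z) :
    ∃ K : ℝ, 0 < K ∧ ∀ x : X, ∃ y z : X, 0 ≤ y ∧ 0 ≤ z ∧ x = y - z ∧
      ‖y‖ ≤ K * ‖x‖ ∧ ‖z‖ ≤ K * ‖x‖ := by
  classical
  let u : {x : X // 0 ≤ x ∧ ‖x‖ ≤ 1} → X := Subtype.val
  have hu0 : ∀ i, 0 ≤ u i := fun i => i.2.1
  have hu : ∀ i, ‖u i‖ ≤ 1 := fun i => i.2.2
  have hmem (y : X) (hy : 0 ≤ y) : ∃ f, lpOneLift u hu f = y := by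
    rcases eq_or_ne y 0 with rfl | hne
    · exact ⟨0, map_zero _⟩
    have hpos : ‖y‖ ≠ 0 := norm_ne_zero_iff.mpr hne
    refine ⟨lp.single 1 ⟨‖y‖⁻¹ • y, smul_nonneg (by positivity) hy, ?_⟩ ‖y‖, ?_⟩
    · rw [norm_smul, norm_inv, norm_norm, inv_mul_cancel₀ hpos]
    · rw [lpOneLift_single]
      exact smul_inv_smul₀ hpos y
  have hsurj : Function.Surjective (lpOneLift u hu) := by
    intro x
    obtain ⟨y, z, hy, hz, rfl⟩ := hgen x
    obtain ⟨f, rfl⟩ := hmem y hy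
    obtain ⟨g, rfl⟩ := hmem z hz
    exact ⟨f - g, map_sub _ _ _⟩
  obtain ⟨K, hK, hpre⟩ := (lpOneLift u hu).exists_preimage_norm_le hsurj
  refine ⟨K, hK, fun x => ?_⟩
  obtain ⟨f, rfl, hf⟩ := hpre x
  have hs := lp_one_summable_norm f
  have hpart (c : {x : X // 0 ≤ x ∧ ‖x‖ ≤ 1} → ℝ) (hc : ∀ i, ‖c i‖ ≤ ‖f i‖) :
      Summable (fun i => c i • u i) ∧ ‖∑' i, c i • u i‖ ≤ K * ‖lpOneLift u hu f‖ := by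
    have hcs : Summable fun i => ‖c i‖ := hs.of_nonneg_of_le (fun _ => norm_nonneg _) hc
    refine ⟨summable_smul_of_norm_le_one hcs hu, ?_⟩
    calc ‖∑' i, c i • u i‖ ≤ ∑' i, ‖c i‖ := norm_tsum_smul_le_of_norm_le_one hcs hu
      _ ≤ ∑' i, ‖f i‖ := hcs.tsum_le_tsum hc hs
      _ = ‖f‖ := (lp_one_norm_eq_tsum f).symm
      _ ≤ _ := hf
  obtain ⟨hsp, hnp⟩ := hpart (fun i => (f i)⁺) fun i => by
    rw [Real.norm_of_nonneg (posPart_nonneg _)]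
    exact sup_le (le_abs_self _) (abs_nonneg _)
  obtain ⟨hsn, hnn⟩ := hpart (fun i => (f i)⁻) fun i => by
    rw [Real.norm_of_nonneg (negPart_nonneg _)]
    exact sup_le (neg_le_abs _) (abs_nonneg _)
  refine ⟨_, _, tsum_nonneg fun i => smul_nonneg (posPart_nonneg _) (hu0 i),
    tsum_nonneg fun i => smul_nonneg (negPart_nonneg _) (hu0 i), ?_, hnp, hnn⟩
  rw [← hsp.tsum_sub hsn, lpOneLift_apply]
  simp only [← sub_smul, posPart_sub_negPart]


/-- Every collectively order to norm bounded set of operators from an ordered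
Banach space with closed generating positive cone to a normed space is bounded
in the operator norm. -/
theorem collectively_order_to_norm_bounded_on_ordered_banach_space
    {X Y : Type*} [NormedAddCommGroup X] [NormedSpace ℝ X] [CompleteSpace X]
    [PartialOrder X] [CovariantClass X X (· + ·) (· ≤ ·)] [PosSMulMono ℝ X]
    [NormedAddCommGroup Y] [NormedSpace ℝ Y]
    (hclosed : IsClosed {x : X | 0 ≤ x})
    (hgen : ∀ x : X, ∃ y z : X, 0 ≤ y ∧ 0 ≤ z ∧ x = y - z)
    (𝒯 : Set (X →ₗ[ℝ] Y))
    (h : ∀ b : X, 0 ≤ b → ∃ C : ℝ, ∀ T ∈ 𝒯, ∀ x : X, 0 ≤ x → x ≤ b → ‖T x‖ ≤ C) :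
    ∃ M : ℝ, 0 ≤ M ∧ ∀ T ∈ 𝒯, ∀ x : X, ‖T x‖ ≤ M * ‖x‖ := by
  have : IsOrderedAddMonoid X :=
    { add_le_add_left := fun a b hab c => by
        rw [add_comm a c, add_comm b c]
        exact CovariantClass.elim c hab }
  have : OrderClosedTopology X :=
    ⟨by
      convert hclosed.preimage (continuous_snd.sub continuous_fst) using 1
      ext p
      exact sub_nonneg.symm⟩
  obtain ⟨C, hC⟩ := exists_norm_le_on_nonneg_unitBall 𝒯 h
  obtain ⟨K, hK, hdecomp⟩ := exists_nonneg_sub_nonneg_norm_le hgen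
  have hpos (T) (hT : T ∈ 𝒯) (y : X) (hy : 0 ≤ y) : ‖T y‖ ≤ |C| * ‖y‖ := by
    rcases eq_or_ne y 0 with rfl | hne
    · simp
    have hn : 0 < ‖y‖ := norm_pos_iff.mpr hne
    have hle := hC T hT (‖y‖⁻¹ • y) (smul_nonneg (by positivity) hy)
      (by rw [norm_smul, norm_inv, norm_norm, inv_mul_cancel₀ hn.ne'])
    rw [map_smul, norm_smul, norm_inv, norm_norm, inv_mul_le_iff₀ hn, mul_comm] at hle
    exact hle.trans (mul_le_mul_of_nonneg_right (le_abs_self C) hn.le)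
  refine ⟨2 * |C| * K, by positivity, fun T hT x => ?_⟩
  obtain ⟨y, z, hy, hz, hx, hyK, hzK⟩ := hdecomp x
  calc ‖T x‖ = ‖T y - T z‖ := by rw [hx, map_sub]
    _ ≤ ‖T y‖ + ‖T z‖ := norm_sub_le _ _
    _ ≤ |C| * ‖y‖ + |C| * ‖z‖ := add_le_add (hpos T hT y hy) (hpos T hT z hz)
    _ ≤ |C| * (K * ‖x‖) + |C| * (K * ‖x‖) := by gcongr
    _ = 2 * |C| * K * ‖x‖ := by ring
end

section
/- Let E be an Archimedean vector lattice and F a finite-dimensional vector lattice. Every collectively uo-continuous set of linear operators from E to F is collectively order bounded. -/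
universe uJ uA uB uE uF

section Defs

variable {E : Type uE} [Lattice E] [AddCommGroup E]

/-- `le` is a directed preorder (given as a raw relation) on a nonempty index type. -/
def IsDirPre {J : Type uJ} (le : J → J → Prop) : Prop :=
  Nonempty J ∧ (∀ j, le j j) ∧ (∀ a b c, le a b → le b c → le a c) ∧
    ∀ a b, ∃ c, le a c ∧ le b c

/-- The net `g : J → E` is decreasing with infimum `0` (w.r.t. `le`): `g ↓ 0`. -/
def DownTo0 {J : Type uJ} (le : J → J → Prop) (g : J → E) : Prop :=
  (∀ j₁ j₂, le j₁ j₂ → g j₂ ≤ g j₁) ∧ IsGLB (Set.range g) (0 : E)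

/-- The family of nets `x : B → A → E` collectively order converges to `0`:
there is a net `g ↓ 0` such that for every index `j` there is `α₀` with
`|x b α| ≤ g j` for all `α ≥ α₀` and all `b`. -/
def CoOConv0 {A : Type uA} [Preorder A] {B : Type uB} (x : B → A → E) : Prop :=
  ∃ (J : Type uJ) (le : J → J → Prop) (g : J → E),
    IsDirPre le ∧ DownTo0 le g ∧
      ∀ j : J, ∃ α₀ : A, ∀ (b : B) (α : A), α₀ ≤ α → |x b α| ≤ g j

/-- The family of nets `x : B → A → E` collectively uo-converges to `0`. -/
def CoUoConv0 {A : Type uA} [Preorder A] {B : Type uB} (x : B → A → E) : Prop :=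
  ∀ w : E, 0 ≤ w → CoOConv0.{uJ} (fun b α => |x b α| ⊓ w)

/-- The net `x : A → E` uo-converges to `0`. -/
def UoConv0 {A : Type uA} [Preorder A] (x : A → E) : Prop :=
  CoUoConv0.{uJ} (fun _ : Unit => x)

variable {F : Type uF} [Lattice F] [AddCommGroup F] [Module ℝ E] [Module ℝ F]

/-- `𝒯` is collectively order bounded: `𝒯[0,b]` is order bounded for every `b ∈ E₊`. -/
def CollOBounded (𝒯 : Set (E →ₗ[ℝ] F)) : Prop :=
  ∀ b : E, 0 ≤ b → ∃ w₁ w₂ : F, ∀ T ∈ 𝒯, ∀ x : E, 0 ≤ x → x ≤ b → w₁ ≤ T x ∧ T x ≤ w₂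

/-- `𝒯` is collectively uo-continuous. -/
def CollUoContinuous (𝒯 : Set (E →ₗ[ℝ] F)) : Prop :=
  ∀ (A : Type uA) [Preorder A] [IsDirected A (· ≤ ·)] [Nonempty A],
    ∀ x : A → E, UoConv0.{uJ} x →
      CoUoConv0.{uJ} (fun (T : 𝒯) (α : A) => (T : E →ₗ[ℝ] F) (x α))

end Defs

section OrderedGroup

variable {G : Type*} [Lattice G] [AddCommGroup G] [IsOrderedAddMonoid G]

theorem add_inf_le_inf_add_inf {x y z : G} (hx : 0 ≤ x) (hy : 0 ≤ y) (hz : 0 ≤ z) :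
    (x + y) ⊓ z ≤ x ⊓ z + y ⊓ z := by
  rw [inf_add, add_inf, add_inf]
  refine le_inf (le_inf inf_le_left ?_) (le_inf ?_ ?_) <;> refine inf_le_right.trans ?_
  · exact le_add_of_nonneg_left hx
  · exact le_add_of_nonneg_right hy
  · exact le_add_of_nonneg_right hz

theorem nsmul_inf_eq_zero {x z : G} (hx : 0 ≤ x) (hz : 0 ≤ z) (h : x ⊓ z = 0) (n : ℕ) :
    (n • x) ⊓ z = 0 := by
  induction n with
  | zero => simpa using hz
  | succ n ih =>
    refine le_antisymm ?_ (le_inf (nsmul_nonneg hx _) hz)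
    rw [succ_nsmul]
    exact (add_inf_le_inf_add_inf (nsmul_nonneg hx n) hx hz).trans (by rw [ih, h, add_zero])

theorem eq_zero_of_inf_eq_zero_of_le_nsmul {x e : G} (hx : 0 ≤ x) (he : 0 ≤ e)
    (h : x ⊓ e = 0) {n : ℕ} (hn : x ≤ n • e) : x = 0 := by
  rw [inf_comm] at h
  rw [← nsmul_inf_eq_zero he hx h n, inf_eq_right.2 hn]

theorem le_of_inf_two_nsmul_le {a e : G} (he : 0 ≤ e) (hu : ∀ x : G, ∃ n : ℕ, |x| ≤ n • e)
    (h : a ⊓ (2 • e) ≤ e) : a ≤ e := by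
  have h₁ : (a - e) ⊓ e ≤ 0 := by
    have h₂ : (a - e) ⊓ e + e = a ⊓ (2 • e) := by rw [inf_add, sub_add_cancel, two_nsmul]
    exact nonpos_of_add_le_left (h₂.trans_le h)
  have h₃ : (a - e)⁺ ⊓ e = 0 := by
    let : DistribLattice G := AddCommGroup.toDistribLattice G
    rw [posPart_def, inf_sup_right, inf_eq_left.2 he, sup_eq_right.2 h₁]
  obtain ⟨n, hn⟩ := hu (a - e)⁺
  have h₄ := eq_zero_of_inf_eq_zero_of_le_nsmul (posPart_nonneg _) he h₃ ((le_abs_self _).trans hn)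
  exact sub_nonpos.1 (posPart_eq_zero.1 h₄)

theorem inf_le_of_posPart_sub_disjoint {c e g : G} (hc : 0 ≤ c) (hg : 0 ≤ g)
    (h : c ⊓ (e - g)⁺ = 0) : c ⊓ e ≤ g := by
  rw [← sub_nonpos, ← posPart_eq_zero]
  refine le_antisymm (h ▸ le_inf ?_ ?_) (posPart_nonneg _)
  · exact sup_le ((sub_le_self _ hg).trans inf_le_left) hc
  · exact posPart_mono (sub_le_sub_right inf_le_right _)

theorem abs_nsmul_le_nsmul_abs (n : ℕ) (x : G) : |n • x| ≤ n • |x| :=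
  abs_le'.2 ⟨nsmul_le_nsmul_right (le_abs_self x) n, by
    rw [← smul_neg]; exact nsmul_le_nsmul_right (neg_le_abs x) n⟩

theorem isOrderedAddMonoid_of_covariantClass {H : Type*} [Lattice H] [AddCommGroup H]
    [CovariantClass H H (· + ·) (· ≤ ·)] : IsOrderedAddMonoid H where
  add_le_add_left _ _ h c := by
    simpa only [add_comm _ c] using CovariantClass.elim (μ := (· + ·)) c h

end OrderedGroup

section VectorLattice

variable {V : Type*} [Lattice V] [AddCommGroup V] [IsOrderedAddMonoid V]
  [Module ℝ V] [PosSMulMono ℝ V]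

theorem abs_smul_le_nsmul_abs (a : ℝ) (x : V) : ∃ n : ℕ, |a • x| ≤ n • |x| := by
  obtain ⟨n, hn⟩ := exists_nat_ge |a|
  have key : ∀ (c : ℝ) (y : V), 0 ≤ c → c ≤ n → c • y ≤ n • |y| := by
    intro c y hc hcn
    have h₁ : c • y ≤ c • |y| := smul_le_smul_of_nonneg_left (le_abs_self y) hc
    have h₂ : 0 ≤ ((n : ℝ) - c) • |y| := smul_nonneg (sub_nonneg.2 hcn) (abs_nonneg y)
    rw [sub_smul, Nat.cast_smul_eq_nsmul, sub_nonneg] at h₂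
    exact h₁.trans h₂
  refine ⟨n, abs_le'.2 ?_⟩
  rcases le_total 0 a with ha | ha
  · rw [abs_of_nonneg ha] at hn
    exact ⟨key a x ha hn, by simpa using key a (-x) ha hn⟩
  · rw [abs_of_nonpos ha] at hn
    have ha' : 0 ≤ -a := neg_nonneg.2 ha
    exact ⟨by simpa using key (-a) (-x) ha' hn, by simpa using key (-a) x ha' hn⟩

/-- The disjoint complement of a nonnegative element, as a subspace. -/
def disjointSubmodule (z : V) (hz : 0 ≤ z) : Submodule ℝ V where
  carrier := {x | |x| ⊓ z = 0}
  zero_mem' := by simpa using hz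
  add_mem' := by
    intro x y (hx : |x| ⊓ z = 0) (hy : |y| ⊓ z = 0)
    refine le_antisymm ?_ (le_inf (abs_nonneg _) hz)
    calc |x + y| ⊓ z ≤ (|x| + |y|) ⊓ z := inf_le_inf_right _ (abs_add_le x y)
      _ ≤ |x| ⊓ z + |y| ⊓ z := add_inf_le_inf_add_inf (abs_nonneg x) (abs_nonneg y) hz
      _ = 0 := by rw [hx, hy, add_zero]
  smul_mem' := by
    intro a x (hx : |x| ⊓ z = 0)
    obtain ⟨n, hn⟩ := abs_smul_le_nsmul_abs a x
    refine le_antisymm ?_ (le_inf (abs_nonneg _) hz)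
    exact (inf_le_inf_right _ hn).trans (nsmul_inf_eq_zero (abs_nonneg x) hz hx n).le

theorem mem_disjointSubmodule {z : V} {hz : 0 ≤ z} {x : V} :
    x ∈ disjointSubmodule z hz ↔ |x| ⊓ z = 0 := Iff.rfl

theorem disjointSubmodule_anti {z w : V} (hz : 0 ≤ z) (hw : 0 ≤ w) (h : z ≤ w) :
    disjointSubmodule w hw ≤ disjointSubmodule z hz := fun x hx =>
  le_antisymm ((inf_le_inf_left _ h).trans (mem_disjointSubmodule.1 hx).le)
    (le_inf (abs_nonneg x) hz)

theorem exists_strong_unit [FiniteDimensional ℝ V] :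
    ∃ e : V, 0 ≤ e ∧ ∀ x : V, ∃ n : ℕ, |x| ≤ n • e := by
  let b := Module.finBasis ℝ V
  have he : 0 ≤ ∑ i, |b i| := Finset.sum_nonneg fun i _ => abs_nonneg _
  refine ⟨∑ i, |b i|, he, fun x => ?_⟩
  choose n hn using fun i => abs_smul_le_nsmul_abs (b.repr x i) (b i)
  refine ⟨∑ i, n i, ?_⟩
  rw [← Finset.sum_nsmul_assoc]
  calc |x| = |∑ i, b.repr x i • b i| := by rw [b.sum_repr]
    _ ≤ ∑ i, |b.repr x i • b i| :=
      Finset.le_sum_of_subadditive _ abs_zero.le abs_add_le _ _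
    _ ≤ ∑ i, n i • |b i| := Finset.sum_le_sum fun i _ => hn i
    _ ≤ ∑ i, n i • ∑ k, |b k| := Finset.sum_le_sum fun i _ => nsmul_le_nsmul_right
      (Finset.single_le_sum (f := fun k => |b k|) (fun k _ => abs_nonneg _) (Finset.mem_univ i)) _

/-- In a finite-dimensional vector lattice (Archimedean or not), a net decreasing to `0` is
eventually below any strong unit. -/
theorem DownTo0.exists_le_strong_unit [FiniteDimensional ℝ V] {J : Type*} {le : J → J → Prop}
    {g : J → V} (hle : IsDirPre le) (hg : DownTo0 le g) {e : V} (he : 0 ≤ e)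
    (hu : ∀ x : V, ∃ n : ℕ, |x| ≤ n • e) : ∃ j, g j ≤ e := by
  obtain ⟨⟨j₁⟩, -, -, hdir⟩ := hle
  obtain ⟨hanti, hglb⟩ := hg
  have hg0 : ∀ j, 0 ≤ g j := fun j => hglb.1 ⟨j, rfl⟩
  let D : J → Submodule ℝ V := fun j => disjointSubmodule (e - g j)⁺ (posPart_nonneg _)
  have hD : ∀ i j, le i j → D j ≤ D i := fun i j hij =>
    disjointSubmodule_anti _ _ (posPart_mono (sub_le_sub_left (hanti i j hij) _))
  obtain ⟨_, ⟨j₀, rfl⟩, hmin⟩ :=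
    wellFounded_lt.has_min (Set.range D) ⟨_, j₁, rfl⟩
  set c := (g j₀ - e)⁺ with hc_def
  have hc : 0 ≤ c := posPart_nonneg _
  have hcD : c ∈ D j₀ := by
    rw [mem_disjointSubmodule, abs_of_nonneg hc, hc_def, ← neg_sub (g j₀) e, posPart_neg]
    exact posPart_inf_negPart_eq_zero _
  have hlow : c ⊓ e ∈ lowerBounds (Set.range g) := by
    rintro _ ⟨j, rfl⟩
    obtain ⟨k, hjk, h0k⟩ := hdir j j₀
    have hDk : D k = D j₀ := (hD _ _ h0k).eq_of_not_lt (hmin _ ⟨k, rfl⟩)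
    have hck : c ∈ D k := hDk ▸ hcD
    rw [mem_disjointSubmodule, abs_of_nonneg hc] at hck
    exact (inf_le_of_posPart_sub_disjoint hc (hg0 k) hck).trans (hanti _ _ hjk)
  obtain ⟨n, hn⟩ := hu c
  have hce : c ⊓ e = 0 := le_antisymm (hglb.2 hlow) (le_inf hc he)
  have hc0 := eq_zero_of_inf_eq_zero_of_le_nsmul hc he hce ((le_abs_self c).trans hn)
  exact ⟨j₀, sub_nonpos.1 (posPart_eq_zero.1 hc0)⟩

theorem uoConv0_inv_smul_of_mem_Icc
    (hArch : ∀ x y : V, 0 ≤ x → 0 ≤ y → (∀ n : ℕ, n • x ≤ y) → x = 0)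
    {b : V} (hb : 0 ≤ b) {x : ℕ → V} (hx0 : ∀ n, 0 ≤ x n) (hxb : ∀ n, x n ≤ b) :
    UoConv0.{uJ} (fun m : ULift.{uA} ℕ => ((m.down : ℝ) + 1)⁻¹ • x m.down) := by
  have hpos : ∀ n : ℕ, (0 : ℝ) ≤ ((n : ℝ) + 1)⁻¹ := fun n => by positivity
  intro w hw
  refine ⟨ULift.{uJ} ℕ, (· ≤ ·), fun j => ((j.down : ℝ) + 1)⁻¹ • b,
    ⟨⟨⟨0⟩⟩, le_refl, fun _ _ _ => le_trans, fun i j => ⟨i ⊔ j, le_sup_left, le_sup_right⟩⟩,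
    ?_, fun j => ⟨⟨j.down⟩, ?_⟩⟩
  all_goals
    have hanti : ∀ i j : ℕ, i ≤ j → ((j : ℝ) + 1)⁻¹ • b ≤ ((i : ℝ) + 1)⁻¹ • b := by
      intro i j hij
      have hij' : ((j : ℝ) + 1)⁻¹ ≤ ((i : ℝ) + 1)⁻¹ := by gcongr
      rw [← sub_nonneg, ← sub_smul]
      exact smul_nonneg (sub_nonneg.2 hij') hb
  · refine ⟨fun i j hij => hanti _ _ hij, ?_, fun y hy => ?_⟩
    · rintro _ ⟨j, rfl⟩
      exact smul_nonneg (hpos _) hb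
    · refine posPart_eq_zero.1 (hArch _ b (posPart_nonneg y) hb fun n => ?_)
      have hyn : y⁺ ≤ ((n : ℝ) + 1)⁻¹ • b := sup_le (hy ⟨⟨n⟩, rfl⟩) (smul_nonneg (hpos _) hb)
      have h₁ := smul_le_smul_of_nonneg_left hyn (show (0 : ℝ) ≤ (n : ℝ) + 1 by positivity)
      rw [smul_inv_smul₀ (by positivity), add_smul, one_smul, Nat.cast_smul_eq_nsmul] at h₁
      exact (le_add_of_nonneg_right (posPart_nonneg y)).trans h₁
  · rintro - m hm
    have h0 : 0 ≤ ((m.down : ℝ) + 1)⁻¹ • x m.down := smul_nonneg (hpos _) (hx0 _)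
    rw [abs_of_nonneg (le_inf (abs_nonneg _) hw), abs_of_nonneg h0]
    exact inf_le_left.trans
      ((smul_le_smul_of_nonneg_left (hxb _) (hpos _)).trans (hanti _ _ hm))

end VectorLattice

/-- Every collectively uo-continuous set of operators from an Archimedean
vector lattice `E` to a finite-dimensional vector lattice `F` is collectively
order bounded. -/
theorem collectively_obdd_of_collectively_uo_continuous
    {E : Type uE} [Lattice E] [AddCommGroup E] [CovariantClass E E (· + ·) (· ≤ ·)]
    [Module ℝ E] [PosSMulMono ℝ E]
    {F : Type uF} [Lattice F] [AddCommGroup F] [CovariantClass F F (· + ·) (· ≤ ·)]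
    [Module ℝ F] [PosSMulMono ℝ F] [FiniteDimensional ℝ F]
    (hArch : ∀ x y : E, 0 ≤ x → 0 ≤ y → (∀ n : ℕ, n • x ≤ y) → x = 0)
    (𝒯 : Set (E →ₗ[ℝ] F)) (h : CollUoContinuous.{uJ, uA} 𝒯) :
    CollOBounded 𝒯 := by
  have : IsOrderedAddMonoid E := isOrderedAddMonoid_of_covariantClass
  have : IsOrderedAddMonoid F := isOrderedAddMonoid_of_covariantClass
  intro b hb
  obtain ⟨e, he, hu⟩ := exists_strong_unit (V := F)
  by_contra hcon
  have hex : ∀ n : ℕ, ∃ T ∈ 𝒯, ∃ x : E, 0 ≤ x ∧ x ≤ b ∧ ¬ |T x| ≤ (n + 1) • e := by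
    intro n
    by_contra! hn
    exact hcon ⟨-((n + 1) • e), (n + 1) • e, fun T hT x hx hxb =>
      ⟨neg_le.1 ((neg_le_abs _).trans (hn T hT x hx hxb)),
        (le_abs_self _).trans (hn T hT x hx hxb)⟩⟩
  choose T hT x hx0 hxb hTx using hex
  obtain ⟨J, le, g, hle, hg, hdom⟩ :=
    h (ULift.{uA} ℕ) _ (uoConv0_inv_smul_of_mem_Icc hArch hb hx0 hxb) (2 • e) (nsmul_nonneg he 2)
  obtain ⟨j, hj⟩ := hg.exists_le_strong_unit hle he hu
  obtain ⟨⟨n⟩, hn⟩ := hdom j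
  have hle_e : |T n (((n : ℝ) + 1)⁻¹ • x n)| ≤ e := le_of_inf_two_nsmul_le he hu
    ((le_abs_self _).trans ((hn ⟨T n, hT n⟩ ⟨n⟩ le_rfl).trans hj))
  apply hTx n
  have hcast : T n (x n) = (n + 1) • T n (((n : ℝ) + 1)⁻¹ • x n) := by
    rw [map_smul, ← Nat.cast_smul_eq_nsmul ℝ, Nat.cast_add_one, smul_inv_smul₀ (by positivity)]
  rw [hcast]
  refine le_trans ?_ (nsmul_le_nsmul_right hle_e (n + 1))
  exact abs_nsmul_le_nsmul_abs _ _
end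

section
/- Let E and F be vector lattices. Every collectively order bounded set of linear operators from E to F is collectively ru-continuous. -/
universe uJ uA uB uE uF

section Defs

variable {E : Type uE} [Lattice E] [AddCommGroup E]

/-- The family of nets `x : B → A → E` collectively ru-converges to `0`:
there are `u ≥ 0` and an increasing sequence `(α_n)` of indices with
`|x b α| ≤ (1/n) • u` for all `α ≥ α_n`, `n ≥ 1` and all `b`. -/
def CoRuConv0 [Module ℝ E] {A : Type uA} [Preorder A] {B : Type uB} (x : B → A → E) : Prop :=
  ∃ u : E, 0 ≤ u ∧ ∃ αs : ℕ → A, Monotone αs ∧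
    ∀ n : ℕ, 1 ≤ n → ∀ (b : B) (α : A), αs n ≤ α → |x b α| ≤ (n : ℝ)⁻¹ • u

/-- The net `x : A → E` ru-converges to `0`. -/
def RuConv0 [Module ℝ E] {A : Type uA} [Preorder A] (x : A → E) : Prop :=
  CoRuConv0 (fun _ : Unit => x)

variable {F : Type uF} [Lattice F] [AddCommGroup F] [Module ℝ E] [Module ℝ F]

/-- `𝒯` is collectively ru-continuous. -/
def CollRuContinuous (𝒯 : Set (E →ₗ[ℝ] F)) : Prop :=
  ∀ (A : Type uA) [Preorder A] [IsDirected A (· ≤ ·)] [Nonempty A],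
    ∀ x : A → E, RuConv0 x →
      CoRuConv0 (fun (T : 𝒯) (α : A) => (T : E →ₗ[ℝ] F) (x α))

end Defs

/-- If `T` maps `[0, u + u]` into `[w₁, w₂]`, it maps the ball `|x| ≤ c⁻¹ • u` into the ball
`|y| ≤ c⁻¹ • |w₂ - w₁|`. -/
theorem abs_map_le_inv_smul_of_map_Icc
    {E : Type*} [Lattice E] [AddCommGroup E] [IsOrderedAddMonoid E]
    [Module ℝ E] [PosSMulMono ℝ E]
    {F : Type*} [Lattice F] [AddCommGroup F] [IsOrderedAddMonoid F]
    [Module ℝ F] [PosSMulMono ℝ F]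
    (T : E →ₗ[ℝ] F) {u : E} (hu : 0 ≤ u) {w₁ w₂ : F}
    (hT : ∀ x, 0 ≤ x → x ≤ u + u → w₁ ≤ T x ∧ T x ≤ w₂)
    {c : ℝ} (hc : 0 < c) {x : E} (hx : |x| ≤ c⁻¹ • u) :
    |T x| ≤ c⁻¹ • |w₂ - w₁| := by
  have hy : |c • x| ≤ u := by
    have hsmul : ∀ z : E, z ≤ c⁻¹ • u → c • z ≤ u := fun z hz => by
      simpa [smul_smul, hc.ne'] using smul_le_smul_of_nonneg_left hz hc.le
    refine abs_le'.2 ⟨hsmul x ((le_abs_self x).trans hx), ?_⟩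
    rw [← smul_neg]
    exact hsmul (-x) ((neg_le_abs x).trans hx)
  obtain ⟨hy₂, hy₁⟩ := abs_le'.1 hy
  obtain ⟨h₁, h₂⟩ := hT (c • x + u) (neg_le_iff_add_nonneg'.1 hy₁) (add_le_add_left hy₂ u)
  obtain ⟨h₃, h₄⟩ := hT u hu (le_add_of_nonneg_left hu)
  have hTx : T x = c⁻¹ • (T (c • x + u) - T u) := by
    simp [smul_smul, hc.ne']
  have hc' : 0 ≤ c⁻¹ := (inv_pos.2 hc).le
  rw [hTx]
  refine abs_le'.2 ⟨smul_le_smul_of_nonneg_left ?_ hc', ?_⟩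
  · exact (sub_le_sub h₂ h₃).trans (le_abs_self _)
  · rw [← smul_neg, neg_sub]
    exact smul_le_smul_of_nonneg_left ((sub_le_sub h₄ h₁).trans (le_abs_self _)) hc'

/-- Every collectively order bounded set of operators between vector lattices
is collectively ru-continuous. -/
theorem collectively_ru_continuous_of_collectively_obdd
    {E : Type uE} [Lattice E] [AddCommGroup E] [CovariantClass E E (· + ·) (· ≤ ·)]
    [Module ℝ E] [PosSMulMono ℝ E]
    {F : Type uF} [Lattice F] [AddCommGroup F] [CovariantClass F F (· + ·) (· ≤ ·)]
    [Module ℝ F] [PosSMulMono ℝ F]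
    (𝒯 : Set (E →ₗ[ℝ] F)) (h : CollOBounded 𝒯) :
    CollRuContinuous.{uA} 𝒯 := by
  have : IsOrderedAddMonoid E := .mk (fun _ _ hab c => add_le_add_left hab c) fun _ _ hab c => add_le_add_right hab c
  have : IsOrderedAddMonoid F := .mk (fun _ _ hab c => add_le_add_left hab c) fun _ _ hab c => add_le_add_right hab c
  rintro A _ _ _ x ⟨u, hu, αs, hαs, hx⟩
  obtain ⟨w₁, w₂, hw⟩ := h (u + u) (add_nonneg hu hu)
  refine ⟨|w₂ - w₁|, abs_nonneg _, αs, hαs, fun n hn T α hα => ?_⟩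
  exact abs_map_le_inv_smul_of_map_Icc T.1 hu (hw T.1 T.2) (Nat.cast_pos.2 hn) (hx n hn () α hα)
end

section
/- Let E and F be vector lattices, r₁, r₂ ∈ ℝ, and let 𝒯₁ and 𝒯₂ be nonempty collectively order continuous sets of linear operators from E to F. Then the union 𝒯₁ ∪ 𝒯₂ and the set r₁𝒯₁ + r₂𝒯₂ = {r₁T₁ + r₂T₂ : T₁ ∈ 𝒯₁, T₂ ∈ 𝒯₂} are collectively order continuous. -/
universe uJ uA uB uE uF

section Defs

variable {E : Type uE} [Lattice E] [AddCommGroup E]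

/-- The net `x : A → E` order converges to `0`. -/
def OConv0 {A : Type uA} [Preorder A] (x : A → E) : Prop :=
  CoOConv0.{uJ} (fun _ : Unit => x)

variable {F : Type uF} [Lattice F] [AddCommGroup F] [Module ℝ E] [Module ℝ F]

/-- `𝒯` is collectively order continuous. -/
def CollOContinuous (𝒯 : Set (E →ₗ[ℝ] F)) : Prop :=
  ∀ (A : Type uA) [Preorder A] [IsDirected A (· ≤ ·)] [Nonempty A],
    ∀ x : A → E, OConv0.{uJ} x →
      CoOConv0.{uJ} (fun (T : 𝒯) (α : A) => (T : E →ₗ[ℝ] F) (x α))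

end Defs

theorem DownTo0.const_smul {F : Type uF} [Lattice F] [AddCommGroup F] [Module ℝ F]
    [PosSMulMono ℝ F] {J : Type uJ} {le : J → J → Prop} {g : J → F} {c : ℝ}
    (hc : 0 < c) (h : DownTo0 le g) : DownTo0 le (fun j => c • g j) := by
  refine ⟨fun i j hij => smul_le_smul_of_nonneg_left (h.1 i j hij) hc.le, ?_, fun b hb => ?_⟩
  · rintro _ ⟨j, rfl⟩
    exact smul_nonneg hc.le (h.2.1 ⟨j, rfl⟩)
  · have hle : c⁻¹ • b ≤ 0 := h.2.2 <| by
      rintro _ ⟨j, rfl⟩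
      simpa [smul_smul, hc.ne'] using
        smul_le_smul_of_nonneg_left (hb ⟨j, rfl⟩) (inv_nonneg.mpr hc.le)
    simpa [smul_smul, hc.ne'] using smul_le_smul_of_nonneg_left hle hc.le

section CollectiveOrderConvergence

variable {F : Type uF} [Lattice F] [AddCommGroup F] [IsOrderedAddMonoid F]

theorem IsDirPre.prod {J₁ J₂ : Type uJ} {le₁ : J₁ → J₁ → Prop} {le₂ : J₂ → J₂ → Prop}
    (h₁ : IsDirPre le₁) (h₂ : IsDirPre le₂) :
    IsDirPre (fun p q : J₁ × J₂ => le₁ p.1 q.1 ∧ le₂ p.2 q.2) := by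
  obtain ⟨⟨j₁⟩, refl₁, trans₁, dir₁⟩ := h₁
  obtain ⟨⟨j₂⟩, refl₂, trans₂, dir₂⟩ := h₂
  refine ⟨⟨(j₁, j₂)⟩, fun p => ⟨refl₁ _, refl₂ _⟩,
    fun a b c hab hbc => ⟨trans₁ _ _ _ hab.1 hbc.1, trans₂ _ _ _ hab.2 hbc.2⟩, fun a b => ?_⟩
  obtain ⟨c₁, hac₁, hbc₁⟩ := dir₁ a.1 b.1
  obtain ⟨c₂, hac₂, hbc₂⟩ := dir₂ a.2 b.2
  exact ⟨(c₁, c₂), ⟨hac₁, hac₂⟩, hbc₁, hbc₂⟩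

theorem DownTo0.add_prod {J₁ J₂ : Type uJ} {le₁ : J₁ → J₁ → Prop} {le₂ : J₂ → J₂ → Prop}
    {g₁ : J₁ → F} {g₂ : J₂ → F} (h₁ : DownTo0 le₁ g₁) (h₂ : DownTo0 le₂ g₂) :
    DownTo0 (fun p q : J₁ × J₂ => le₁ p.1 q.1 ∧ le₂ p.2 q.2) (fun p => g₁ p.1 + g₂ p.2) := by
  refine ⟨fun p q hpq => add_le_add (h₁.1 _ _ hpq.1) (h₂.1 _ _ hpq.2), ?_⟩
  have hrange : Set.range (fun p : J₁ × J₂ => g₁ p.1 + g₂ p.2) =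
      Set.image2 (· + ·) (Set.range g₁) (Set.range g₂) := by
    rw [Set.image2_range]
  rw [hrange, Set.image2_add]
  simpa using h₁.2.add h₂.2

/-- A family dominated by sums of members of two collectively order null families is
collectively order null. -/
theorem CoOConv0.of_abs_le_add {A : Type uA} [Preorder A] [IsDirected A (· ≤ ·)]
    {B₁ B₂ B₃ : Type*} {x : B₁ → A → F} {y : B₂ → A → F} {z : B₃ → A → F}
    (hx : CoOConv0.{uJ} x) (hy : CoOConv0.{uJ} y)
    (hz : ∀ b, ∃ b₁ b₂, ∀ α, |z b α| ≤ |x b₁ α| + |y b₂ α|) : CoOConv0.{uJ} z := by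
  obtain ⟨J₁, le₁, g₁, hd₁, hg₁, hx⟩ := hx
  obtain ⟨J₂, le₂, g₂, hd₂, hg₂, hy⟩ := hy
  refine ⟨J₁ × J₂, _, _, hd₁.prod hd₂, hg₁.add_prod hg₂, fun j => ?_⟩
  obtain ⟨α₁, hα₁⟩ := hx j.1
  obtain ⟨α₂, hα₂⟩ := hy j.2
  obtain ⟨α₀, h₁, h₂⟩ := exists_ge_ge α₁ α₂
  refine ⟨α₀, fun b α hα => ?_⟩
  obtain ⟨b₁, b₂, hb⟩ := hz b
  exact (hb α).trans (add_le_add (hα₁ b₁ α (h₁.trans hα)) (hα₂ b₂ α (h₂.trans hα)))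

variable [Module ℝ F] [PosSMulMono ℝ F]

theorem abs_smul_le_abs_add_one_smul_abs (r : ℝ) (x : F) : |r • x| ≤ (|r| + 1) • |x| := by
  have key : ∀ (s : ℝ) (y : F), s ≤ |r| → 0 ≤ s → |y| = |x| → s • y ≤ (|r| + 1) • |x| := by
    intro s y hs hs0 hy
    have hrest : 0 ≤ (|r| + 1 - s) • |x| := smul_nonneg (by linarith) (abs_nonneg x)
    calc s • y ≤ s • |x| := smul_le_smul_of_nonneg_left (hy ▸ le_abs_self y) hs0
      _ ≤ s • |x| + (|r| + 1 - s) • |x| := le_add_of_nonneg_right hrest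
      _ = (|r| + 1) • |x| := by rw [← add_smul]; congr 1; ring
  rw [abs_le']
  rcases le_total 0 r with hr | hr
  · refine ⟨key r x (le_abs_self r) hr rfl, ?_⟩
    rw [← smul_neg]
    exact key r (-x) (le_abs_self r) hr (abs_neg x)
  · have hr' : 0 ≤ -r := neg_nonneg.mpr hr
    refine ⟨?_, ?_⟩
    · rw [← neg_smul_neg]
      exact key (-r) (-x) (neg_le_abs r) hr' (abs_neg x)
    · rw [← neg_smul]
      exact key (-r) x (neg_le_abs r) hr' rfl

theorem CoOConv0.const_smul {A : Type uA} [Preorder A] {B : Type*} {x : B → A → F}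
    (hx : CoOConv0.{uJ} x) (r : ℝ) : CoOConv0.{uJ} (fun b α => r • x b α) := by
  obtain ⟨J, le, g, hd, hg, hx⟩ := hx
  have hc : 0 < |r| + 1 := by positivity
  refine ⟨J, le, _, hd, hg.const_smul hc, fun j => ?_⟩
  obtain ⟨α₀, hα₀⟩ := hx j
  exact ⟨α₀, fun b α hα => (abs_smul_le_abs_add_one_smul_abs r _).trans
    (smul_le_smul_of_nonneg_left (hα₀ b α hα) hc.le)⟩

end CollectiveOrderConvergence

/-- Unions and linear combinations of collectively order continuous sets of
operators are collectively order continuous. -/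
theorem collectively_order_continuous_union_and_linear_combination
    {E : Type uE} [Lattice E] [AddCommGroup E] [CovariantClass E E (· + ·) (· ≤ ·)]
    [Module ℝ E] [PosSMulMono ℝ E]
    {F : Type uF} [Lattice F] [AddCommGroup F] [CovariantClass F F (· + ·) (· ≤ ·)]
    [Module ℝ F] [PosSMulMono ℝ F]
    (r₁ r₂ : ℝ) (𝒯₁ 𝒯₂ : Set (E →ₗ[ℝ] F)) (h₁ne : 𝒯₁.Nonempty) (h₂ne : 𝒯₂.Nonempty)
    (h₁ : CollOContinuous.{uJ, uA} 𝒯₁) (h₂ : CollOContinuous.{uJ, uA} 𝒯₂) :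
    CollOContinuous.{uJ, uA} (𝒯₁ ∪ 𝒯₂) ∧
      CollOContinuous.{uJ, uA}
        {S : E →ₗ[ℝ] F | ∃ T₁ ∈ 𝒯₁, ∃ T₂ ∈ 𝒯₂, S = r₁ • T₁ + r₂ • T₂} := by
  have : IsOrderedAddMonoid F :=
    { add_le_add_left := fun a b hab c => by
        simpa only [add_comm _ c] using CovariantClass.elim (μ := (· + ·)) c hab }
  refine ⟨fun A _ _ _ x hx => ?_, fun A _ _ _ x hx => ?_⟩
  · obtain ⟨S₁, hS₁⟩ := h₁ne
    obtain ⟨S₂, hS₂⟩ := h₂ne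
    refine (h₁ A x hx).of_abs_le_add (h₂ A x hx) ?_
    rintro ⟨T, hT | hT⟩
    · exact ⟨⟨T, hT⟩, ⟨S₂, hS₂⟩, fun α => le_add_of_nonneg_right (abs_nonneg _)⟩
    · exact ⟨⟨S₁, hS₁⟩, ⟨T, hT⟩, fun α => le_add_of_nonneg_left (abs_nonneg _)⟩
  · refine ((h₁ A x hx).const_smul r₁).of_abs_le_add ((h₂ A x hx).const_smul r₂) ?_
    rintro ⟨_, T₁, hT₁, T₂, hT₂, rfl⟩
    exact ⟨⟨T₁, hT₁⟩, ⟨T₂, hT₂⟩, fun α => abs_add_le _ _⟩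
end

section
/- Let E and F be vector lattices, r₁, r₂ ∈ ℝ, and let 𝒯₁ and 𝒯₂ be nonempty collectively ru-continuous sets of linear operators from E to F. Then the union 𝒯₁ ∪ 𝒯₂ and the set r₁𝒯₁ + r₂𝒯₂ = {r₁T₁ + r₂T₂ : T₁ ∈ 𝒯₁, T₂ ∈ 𝒯₂} are collectively ru-continuous. -/
universe uJ uA uB uE uF

section Helpers

lemma exists_monotone_upper_bound {A : Type*} [Preorder A] [IsDirected A (· ≤ ·)]
    (f g : ℕ → A) : ∃ h : ℕ → A, Monotone h ∧ ∀ n, f n ≤ h n ∧ g n ≤ h n := by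
  choose ub hl hr using fun a b : A => exists_ge_ge a b
  let h : ℕ → A := fun n =>
    Nat.rec (ub (f 0) (g 0)) (fun k c => ub c (ub (f (k + 1)) (g (k + 1)))) n
  refine ⟨h, monotone_nat_of_le_succ fun n => hl _ _, fun n => ?_⟩
  cases n with
  | zero => exact ⟨hl _ _, hr _ _⟩
  | succ k => exact ⟨(hl _ _).trans (hr _ _), (hr _ _).trans (hr _ _)⟩

variable {F : Type*} [Lattice F] [AddCommGroup F]

lemma abs_add_le_of_abs_le [AddLeftMono F] {a b u v : F} (ha : |a| ≤ u) (hb : |b| ≤ v) :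
    |a + b| ≤ u + v := by
  rw [abs_le'] at *
  exact ⟨add_le_add ha.1 hb.1, (neg_add a b).trans_le (add_le_add ha.2 hb.2)⟩

variable [Module ℝ F]

lemma abs_smul_le_of_abs_le [PosSMulMono ℝ F] {a u : F} (r : ℝ) (ha : |a| ≤ u) : |r • a| ≤ |r| • u := by
  rw [abs_le'] at *
  rcases le_total 0 r with hr | hr
  · rw [abs_of_nonneg hr, ← smul_neg]
    exact ⟨smul_le_smul_of_nonneg_left ha.1 hr, smul_le_smul_of_nonneg_left ha.2 hr⟩
  · have hr' : 0 ≤ -r := neg_nonneg.2 hr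
    rw [abs_of_nonpos hr, ← neg_smul, ← neg_smul_neg r a]
    exact ⟨smul_le_smul_of_nonneg_left ha.2 hr', smul_le_smul_of_nonneg_left ha.1 hr'⟩

variable {A : Type*} [Preorder A] [IsDirected A (· ≤ ·)]

/-- Two collectively ru-null families admit a common index sequence. -/
lemma CoRuConv0.exists_common {B C : Type*} {x : B → A → F} {y : C → A → F}
    (hx : CoRuConv0 x) (hy : CoRuConv0 y) :
    ∃ u v : F, 0 ≤ u ∧ 0 ≤ v ∧ ∃ αs : ℕ → A, Monotone αs ∧ ∀ n : ℕ, 1 ≤ n → ∀ α, αs n ≤ α →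
      (∀ b, |x b α| ≤ (n : ℝ)⁻¹ • u) ∧ ∀ c, |y c α| ≤ (n : ℝ)⁻¹ • v := by
  obtain ⟨u, hu, f, -, hf⟩ := hx
  obtain ⟨v, hv, g, -, hg⟩ := hy
  obtain ⟨h, hh, hfg⟩ := exists_monotone_upper_bound f g
  exact ⟨u, v, hu, hv, h, hh, fun n hn α hα =>
    ⟨fun b => hf n hn b α ((hfg n).1.trans hα), fun c => hg n hn c α ((hfg n).2.trans hα)⟩⟩

end Helpers

/-- Unions and linear combinations of collectively ru-continuous sets of
operators are collectively ru-continuous. -/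
theorem collectively_ru_continuous_union_and_linear_combination
    {E : Type uE} [Lattice E] [AddCommGroup E] [CovariantClass E E (· + ·) (· ≤ ·)]
    [Module ℝ E] [PosSMulMono ℝ E]
    {F : Type uF} [Lattice F] [AddCommGroup F] [CovariantClass F F (· + ·) (· ≤ ·)]
    [Module ℝ F] [PosSMulMono ℝ F]
    (r₁ r₂ : ℝ) (𝒯₁ 𝒯₂ : Set (E →ₗ[ℝ] F)) (h₁ne : 𝒯₁.Nonempty) (h₂ne : 𝒯₂.Nonempty)
    (h₁ : CollRuContinuous.{uA} 𝒯₁) (h₂ : CollRuContinuous.{uA} 𝒯₂) :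
    CollRuContinuous.{uA} (𝒯₁ ∪ 𝒯₂) ∧
      CollRuContinuous.{uA}
        {S : E →ₗ[ℝ] F | ∃ T₁ ∈ 𝒯₁, ∃ T₂ ∈ 𝒯₂, S = r₁ • T₁ + r₂ • T₂} := by
  refine ⟨fun A _ _ _ x hx => ?_, fun A _ _ _ x hx => ?_⟩ <;>
    obtain ⟨u, v, hu, hv, αs, hαs, h⟩ := (h₁ A x hx).exists_common (h₂ A x hx)
  · refine ⟨u + v, add_nonneg hu hv, αs, hαs, fun n hn ⟨T, hT⟩ α hα => ?_⟩
    have hn' : (0 : ℝ) ≤ (n : ℝ)⁻¹ := by positivity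
    rcases hT with hT | hT
    · exact ((h n hn α hα).1 ⟨T, hT⟩).trans
        (smul_le_smul_of_nonneg_left (le_add_of_nonneg_right hv) hn')
    · exact ((h n hn α hα).2 ⟨T, hT⟩).trans
        (smul_le_smul_of_nonneg_left (le_add_of_nonneg_left hu) hn')
  · refine ⟨|r₁| • u + |r₂| • v,
      add_nonneg (smul_nonneg (abs_nonneg r₁) hu) (smul_nonneg (abs_nonneg r₂) hv),
      αs, hαs, ?_⟩
    rintro n hn ⟨_, T₁, hT₁, T₂, hT₂, rfl⟩ α hα
    rw [smul_add, smul_comm _ |r₁|, smul_comm _ |r₂|]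
    exact abs_add_le_of_abs_le (abs_smul_le_of_abs_le r₁ ((h n hn α hα).1 ⟨T₁, hT₁⟩))
      (abs_smul_le_of_abs_le r₂ ((h n hn α hα).2 ⟨T₂, hT₂⟩))
end
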